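/- arXiv:math/0504391 — 2 statements merged into one kernel-verified Lean document; each statement's English description precedes it below -/
import Mathlib

section
/- Let d ≥ 1, p ∈ (1,2], and let a_{ij}, b_i : ℝ^d → ℝ be locally Hölder continuous, with a(x) symmetric and strictly elliptic, and suppose there exists C > 0 such that ∑_{i,j} a_{ij}(x)ν_iν_j ≤ C|ν|²(1+|x|²) and |b(x)| ≤ C(1+|x|) for all x, ν ∈ ℝ^d. Let α, β : ℝ^d → ℝ be locally Hölder continuous with inf_{x∈ℝ^d} α(x) > 0 and β bounded from above. Then the only function u : ℝ^d × [0,∞) → ℝ that is continuous, nonnegative, twice continuously differentiable in x and once in t on ℝ^d × (0,∞), satisfies ∂u/∂t = (1/2)∑_{i,j} a_{ij}(x) ∂²u/∂x_i∂x_j + ∑_i b_i(x) ∂u/∂x_i + β(x)u − α(x)u^p on ℝ^d × (0,∞), and satisfies u(x,0) = 0 for all x ∈ ℝ^d, is u ≡ 0. -/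
open Set

/-- The `i`-th partial derivative of a function on `ℝ^d`. -/
noncomputable def pd {d : ℕ} (i : Fin d) (f : EuclideanSpace ℝ (Fin d) → ℝ)
    (x : EuclideanSpace ℝ (Fin d)) : ℝ :=
  fderiv ℝ f x (EuclideanSpace.single i 1)

/-- `f` is locally Hölder continuous. -/
def LocHolder {d : ℕ} (f : EuclideanSpace ℝ (Fin d) → ℝ) : Prop :=
  ∀ K : Set (EuclideanSpace ℝ (Fin d)), IsCompact K →
    ∃ κ C : ℝ, 0 < κ ∧ κ ≤ 1 ∧ 0 ≤ C ∧
      ∀ x ∈ K, ∀ y ∈ K, |f x - f y| ≤ C * ‖x - y‖ ^ κ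

open Filter Topology

theorem second_deriv_nonpos_of_isLocalMax {g g' : ℝ → ℝ} {g'' x : ℝ}
    (hg : ∀ᶠ s in 𝓝 x, HasDerivAt g (g' s) s) (hg' : HasDerivAt g' g'' x)
    (hmax : IsLocalMax g x) : g'' ≤ 0 := by
  by_contra! hpos
  have h1 : deriv g =ᶠ[𝓝 x] g' := hg.mono fun s hs => hs.deriv
  have h2 : deriv (deriv g) x = g'' := by rw [h1.deriv_eq, hg'.deriv]
  have hmin : IsLocalMin g x :=
    isLocalMin_of_deriv_deriv_pos (h2 ▸ hpos) hmax.deriv_eq_zero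
      hg.self_of_nhds.continuousAt
  have hconst : g =ᶠ[𝓝 x] fun _ => g x := by
    filter_upwards [hmin, hmax] with s h3 h4 using le_antisymm h4 h3
  have h5 : deriv (deriv g) x = 0 := by
    rw [hconst.deriv.deriv_eq]; simp
  linarith

theorem deriv_nonneg_of_left_le {g : ℝ → ℝ} {g' t : ℝ} (ht : 0 < t) (hg : HasDerivAt g g' t)
    (hle : ∀ s, 0 < s → s < t → g s ≤ g t) : 0 ≤ g' := by
  have h := (hasDerivWithinAt_iff_tendsto_slope' (s := Iio t) (by simp)).1 hg.hasDerivWithinAt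
  refine ge_of_tendsto h ?_
  filter_upwards [Ioo_mem_nhdsLT ht] with s hs
  rw [slope_def_field]
  exact div_nonneg_of_nonpos (by linarith [hle s hs.1 hs.2]) (by linarith [hs.2])

section
variable {d : ℕ}
local notation "E" => EuclideanSpace ℝ (Fin d)

theorem hasDerivAt_fderiv_line {f : E → ℝ} (hf : ContDiff ℝ 2 f) (x c : E) :
    HasDerivAt (fun s : ℝ => fderiv ℝ f (x + s • c) c) (fderiv ℝ (fderiv ℝ f) x c c) 0 := by
  have hline : HasDerivAt (fun s : ℝ => x + s • c) c 0 := by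
    simpa using ((hasDerivAt_id (0 : ℝ)).smul_const c).const_add x
  have hdiff : Differentiable ℝ (fderiv ℝ f) :=
    (hf.fderiv_right (m := 1) (by norm_num)).differentiable (by norm_num)
  have hfd : HasFDerivAt (fderiv ℝ f) (fderiv ℝ (fderiv ℝ f) x) (x + (0 : ℝ) • c) := by
    simpa using (hdiff x).hasFDerivAt
  have h1 : HasFDerivAt (fun y => fderiv ℝ f y c)
      ((fderiv ℝ (fderiv ℝ f) x).flip c) (x + (0 : ℝ) • c) := by
    simpa using hfd.clm_apply (hasFDerivAt_const c (x + (0 : ℝ) • c))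
  exact h1.comp_hasDerivAt (0 : ℝ) hline

theorem fderiv_radial_touching {f : E → ℝ} (hf : ContDiff ℝ 2 f) {x : E}
    {F F1 : ℝ → ℝ} {F2 : ℝ} (hF : ∀ᶠ s in 𝓝 (‖x‖ ^ 2), HasDerivAt F (F1 s) s)
    (hF1 : HasDerivAt F1 F2 (‖x‖ ^ 2))
    (hmax : IsLocalMax (fun y => f y - F (‖y‖ ^ 2)) x) (c : E) :
    fderiv ℝ f x c = F1 (‖x‖ ^ 2) * (2 * inner ℝ x c) ∧
      fderiv ℝ (fderiv ℝ f) x c c ≤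
        F2 * (2 * inner ℝ x c) ^ 2 + F1 (‖x‖ ^ 2) * (2 * ‖c‖ ^ 2) := by
  have hline (s : ℝ) : HasDerivAt (fun s : ℝ => x + s • c) c s := by
    simpa using ((hasDerivAt_id s).smul_const c).const_add x
  have hq (s : ℝ) : ‖x + s • c‖ ^ 2 = ‖x‖ ^ 2 + s * (2 * inner ℝ x c) + s ^ 2 * ‖c‖ ^ 2 := by
    rw [norm_add_sq_real, inner_smul_right, norm_smul, mul_pow, Real.norm_eq_abs, sq_abs]
    ring
  have hqd (s : ℝ) : HasDerivAt (fun s : ℝ => ‖x + s • c‖ ^ 2)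
      (2 * inner ℝ x c + s * (2 * ‖c‖ ^ 2)) s := by
    have := (((hasDerivAt_id s).mul_const (2 * inner ℝ x c)).const_add (‖x‖ ^ 2)).add
      ((hasDerivAt_pow 2 s).mul_const (‖c‖ ^ 2))
    refine (this.congr_deriv ?_).congr_of_eventuallyEq (.of_forall fun s => ?_)
    · simp; ring
    · simp [hq]
  have h0 : x + (0 : ℝ) • c = x := by simp
  have hcont : ContinuousAt (fun s : ℝ => ‖x + s • c‖ ^ 2) 0 := (hqd 0).continuousAt
  have hFs : ∀ᶠ s in 𝓝 (0 : ℝ), HasDerivAt F (F1 (‖x + s • c‖ ^ 2)) (‖x + s • c‖ ^ 2) := by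
    have : Tendsto (fun s : ℝ => ‖x + s • c‖ ^ 2) (𝓝 0) (𝓝 (‖x‖ ^ 2)) := by
      have := hcont.tendsto
      simpa only [h0] using this
    exact this.eventually hF
  have hd1 : ∀ᶠ s in 𝓝 (0 : ℝ), HasDerivAt
      (fun s : ℝ => f (x + s • c) - F (‖x + s • c‖ ^ 2))
      (fderiv ℝ f (x + s • c) c -
        F1 (‖x + s • c‖ ^ 2) * (2 * inner ℝ x c + s * (2 * ‖c‖ ^ 2))) s := by
    filter_upwards [hFs] with s hs
    have hfd : HasFDerivAt f (fderiv ℝ f (x + s • c)) (x + s • c) :=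
      (hf.differentiable (by norm_num) _).hasFDerivAt
    exact (hfd.comp_hasDerivAt s (hline s)).sub (hs.comp s (hqd s))
  have hmax0 : IsLocalMax (fun s : ℝ => f (x + s • c) - F (‖x + s • c‖ ^ 2)) 0 := by
    have ht : Tendsto (fun s : ℝ => x + s • c) (𝓝 0) (𝓝 x) := by
      have := (hline 0).continuousAt.tendsto
      simpa only [h0] using this
    have := ht.eventually hmax
    simpa only [IsLocalMax, IsMaxFilter, h0] using this
  have hd2 : HasDerivAt (fun s : ℝ => fderiv ℝ f (x + s • c) c -
        F1 (‖x + s • c‖ ^ 2) * (2 * inner ℝ x c + s * (2 * ‖c‖ ^ 2)))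
      (fderiv ℝ (fderiv ℝ f) x c c -
        (F2 * (2 * inner ℝ x c) * (2 * inner ℝ x c) + F1 (‖x‖ ^ 2) * (2 * ‖c‖ ^ 2))) 0 := by
    have h1 := hasDerivAt_fderiv_line hf x c
    have hF1' : HasDerivAt F1 F2 (‖x + (0 : ℝ) • c‖ ^ 2) := by rwa [h0]
    have h2 := (hF1'.comp (0 : ℝ) (hqd 0)).mul
      (((hasDerivAt_id (0 : ℝ)).mul_const (2 * ‖c‖ ^ 2)).const_add (2 * inner ℝ x c))
    refine (h1.sub h2).congr_deriv ?_
    simp [mul_assoc]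
  constructor
  · have := hmax0.hasDerivAt_eq_zero hd1.self_of_nhds
    simp only [h0, zero_mul, add_zero] at this
    linarith
  · have := second_deriv_nonpos_of_isLocalMax hd1 hd2 hmax0
    linarith

open scoped MatrixOrder in
theorem exists_eq_sum_mul_of_posSemidef {A : Fin d → Fin d → ℝ} (hsymm : ∀ i j, A i j = A j i)
    (hpos : ∀ ν : E, 0 ≤ ∑ i, ∑ j, A i j * ν i * ν j) :
    ∃ c : Fin d → E, ∀ i j, A i j = ∑ k, c k i * c k j := by
  have hA : (Matrix.of A).PosSemidef := by
    refine Matrix.PosSemidef.of_dotProduct_mulVec_nonneg ?_ fun y => ?_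
    · exact Matrix.IsHermitian.ext fun i j => by simp [hsymm j i]
    · refine (hpos (WithLp.toLp 2 y)).trans_eq ?_
      simp only [dotProduct, Matrix.mulVec, Finset.mul_sum]
      refine Finset.sum_congr rfl fun i _ => Finset.sum_congr rfl fun j _ => ?_
      simp; ring
  obtain ⟨B, hB⟩ := CStarAlgebra.nonneg_iff_eq_star_mul_self.mp hA.nonneg
  refine ⟨fun k => WithLp.toLp 2 (B k), fun i j => ?_⟩
  have := congrFun (congrFun hB i) j
  simpa [Matrix.mul_apply, Matrix.star_eq_conjTranspose] using this

theorem pd_pd_eq {f : E → ℝ} (hf : ContDiff ℝ 2 f) (x : E) (i j : Fin d) :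
    pd i (pd j f) x =
      fderiv ℝ (fderiv ℝ f) x (EuclideanSpace.single i 1) (EuclideanSpace.single j 1) := by
  have hdiff : Differentiable ℝ (fderiv ℝ f) :=
    (hf.fderiv_right (m := 1) (by norm_num)).differentiable (by norm_num)
  have h1 : HasFDerivAt (pd j f)
      ((fderiv ℝ (fderiv ℝ f) x).flip (EuclideanSpace.single j 1)) x := by
    have h2 := (hdiff x).hasFDerivAt.clm_apply
      (hasFDerivAt_const (EuclideanSpace.single j (1 : ℝ)) x)
    rw [ContinuousLinearMap.comp_zero, zero_add] at h2
    exact h2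
  rw [pd, h1.fderiv]
  rfl

theorem eq_sum_single (c : E) : c = ∑ i, c i • EuclideanSpace.single i (1 : ℝ) := by
  ext j
  simp [Finset.sum_apply, Pi.single_apply]

/-- If `f - F (‖·‖²)` has a local maximum at `x`, an elliptic operator applied to `f` at `x` is
bounded by its value on the radial function. -/
theorem elliptic_le_radial_of_isLocalMax {f : E → ℝ} (hf : ContDiff ℝ 2 f) {x : E}
    {F F1 : ℝ → ℝ} {F2 : ℝ} (hF : ∀ᶠ s in 𝓝 (‖x‖ ^ 2), HasDerivAt F (F1 s) s)
    (hF1 : HasDerivAt F1 F2 (‖x‖ ^ 2))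
    (hmax : IsLocalMax (fun y => f y - F (‖y‖ ^ 2)) x)
    {A : Fin d → Fin d → ℝ} (hsymm : ∀ i j, A i j = A j i)
    (hpos : ∀ ν : E, 0 ≤ ∑ i, ∑ j, A i j * ν i * ν j) (b : Fin d → ℝ) :
    (1 / 2) * ∑ i, ∑ j, A i j * pd i (pd j f) x + ∑ i, b i * pd i f x ≤
      2 * F2 * ∑ i, ∑ j, A i j * x i * x j +
        F1 (‖x‖ ^ 2) * (∑ i, A i i + 2 * ∑ i, b i * x i) := by
  have htouch := fderiv_radial_touching hf hF hF1 hmax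
  obtain ⟨c, hc⟩ := exists_eq_sum_mul_of_posSemidef hsymm hpos
  have hH (v : E) : fderiv ℝ (fderiv ℝ f) x v v =
      ∑ i, ∑ j, v i * v j * pd i (pd j f) x := by
    conv_lhs => rw [eq_sum_single v]
    simp only [map_sum, sum_apply, map_smul, smul_apply,
      smul_eq_mul, pd_pd_eq hf, Finset.mul_sum]
    rw [Finset.sum_comm]
    refine Finset.sum_congr rfl fun i _ => Finset.sum_congr rfl fun j _ => ?_
    ring
  have hsum (G : Fin d → Fin d → ℝ) :
      ∑ i, ∑ j, A i j * G i j = ∑ k, ∑ i, ∑ j, c k i * c k j * G i j := by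
    simp only [hc, Finset.sum_mul]
    exact (Finset.sum_congr rfl fun i _ => Finset.sum_comm).trans Finset.sum_comm
  have h2 : ∑ i, ∑ j, A i j * pd i (pd j f) x =
      ∑ k, fderiv ℝ (fderiv ℝ f) x (c k) (c k) := by
    simp_rw [hH]
    exact hsum _
  have hinner (v : E) : inner ℝ x v = ∑ i, v i * x i := by
    simp [PiLp.inner_apply]
  have h3 : ∑ i, ∑ j, A i j * x i * x j = ∑ k, (inner ℝ x (c k)) ^ 2 := by
    simp_rw [mul_assoc]
    rw [hsum fun i j => x i * x j]
    refine Finset.sum_congr rfl fun k _ => ?_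
    rw [hinner, sq, Finset.sum_mul_sum]
    refine Finset.sum_congr rfl fun i _ => Finset.sum_congr rfl fun j _ => ?_
    ring
  have h4 : ∑ i, A i i = ∑ k, ‖c k‖ ^ 2 := by
    simp_rw [EuclideanSpace.real_norm_sq_eq, hc, sq]
    rw [Finset.sum_comm]
  have h5 : ∑ i, b i * pd i f x = F1 (‖x‖ ^ 2) * (2 * ∑ i, b i * x i) := by
    simp_rw [pd, (htouch _).1, Finset.mul_sum]
    refine Finset.sum_congr rfl fun i _ => ?_
    simp [EuclideanSpace.inner_single_right]; ring
  have h6 : ∑ k, fderiv ℝ (fderiv ℝ f) x (c k) (c k) ≤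
      ∑ k, (F2 * (2 * inner ℝ x (c k)) ^ 2 + F1 (‖x‖ ^ 2) * (2 * ‖c k‖ ^ 2)) :=
    Finset.sum_le_sum fun k _ => (htouch (c k)).2
  have h7 : ∑ k, (F2 * (2 * inner ℝ x (c k)) ^ 2 + F1 (‖x‖ ^ 2) * (2 * ‖c k‖ ^ 2)) =
      4 * F2 * ∑ k, (inner ℝ x (c k)) ^ 2 + 2 * F1 (‖x‖ ^ 2) * ∑ k, ‖c k‖ ^ 2 := by
    rw [Finset.sum_add_distrib, Finset.mul_sum, Finset.mul_sum]
    congr 1 <;> exact Finset.sum_congr rfl fun k _ => by ring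
  rw [h2, h3, h4, h5]
  linarith


theorem elliptic_le_of_growth {f : E → ℝ} (hf : ContDiff ℝ 2 f) {x : E}
    {F F1 : ℝ → ℝ} {F2 : ℝ} (hF : ∀ᶠ s in 𝓝 (‖x‖ ^ 2), HasDerivAt F (F1 s) s)
    (hF1 : HasDerivAt F1 F2 (‖x‖ ^ 2)) (hF1_nonneg : 0 ≤ F1 (‖x‖ ^ 2)) (hF2_nonneg : 0 ≤ F2)
    (hmax : IsLocalMax (fun y => f y - F (‖y‖ ^ 2)) x)
    {A : Fin d → Fin d → ℝ} (hsymm : ∀ i j, A i j = A j i)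
    (hpos : ∀ ν : E, 0 ≤ ∑ i, ∑ j, A i j * ν i * ν j) {b : Fin d → ℝ} {C : ℝ} (hC : 0 < C)
    (hA : ∀ ν : E, ∑ i, ∑ j, A i j * ν i * ν j ≤ C * ‖ν‖ ^ 2 * (1 + ‖x‖ ^ 2))
    (hb : Real.sqrt (∑ i, (b i) ^ 2) ≤ C * (1 + ‖x‖)) :
    (1 / 2) * ∑ i, ∑ j, A i j * pd i (pd j f) x + ∑ i, b i * pd i f x ≤
      2 * F2 * (C * ‖x‖ ^ 2 * (1 + ‖x‖ ^ 2)) +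
        F1 (‖x‖ ^ 2) * (C * (d + 4) * (1 + ‖x‖ ^ 2)) := by
  have htr : ∑ i, A i i ≤ d * (C * (1 + ‖x‖ ^ 2)) := by
    have h (i : Fin d) : A i i ≤ C * (1 + ‖x‖ ^ 2) := by
      simpa using hA (EuclideanSpace.single i 1)
    simpa using Finset.sum_le_sum fun i (_ : i ∈ Finset.univ) => h i
  have hdrift : ∑ i, b i * x i ≤ C * (1 + ‖x‖) * ‖x‖ := by
    refine (Real.sum_mul_le_sqrt_mul_sqrt _ _ _).trans ?_
    rw [← EuclideanSpace.real_norm_sq_eq x, Real.sqrt_sq (norm_nonneg x)]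
    gcongr
  have h1 : ∑ i, A i i + 2 * ∑ i, b i * x i ≤ C * (d + 4) * (1 + ‖x‖ ^ 2) := by
    nlinarith [mul_nonneg hC.le (sq_nonneg (‖x‖ - 1)), mul_nonneg hC.le (sq_nonneg ‖x‖)]
  refine (elliptic_le_radial_of_isLocalMax hf hF hF1 hmax hsymm hpos b).trans ?_
  gcongr
  exact hA x

/-- Parabolic comparison on a ball with a radial, exponentially weighted barrier. -/
theorem le_radial_barrier {a : Fin d → Fin d → E → ℝ} {b : Fin d → E → ℝ}
    (ha_symm : ∀ i j x, a i j x = a j i x)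
    (ha_pos : ∀ x ν : E, 0 ≤ ∑ i, ∑ j, a i j x * ν i * ν j) {C : ℝ} (hC : 0 < C)
    (ha_bound : ∀ x ν : E, ∑ i, ∑ j, a i j x * ν i * ν j ≤ C * ‖ν‖ ^ 2 * (1 + ‖x‖ ^ 2))
    (hb_bound : ∀ x : E, Real.sqrt (∑ i, (b i x) ^ 2) ≤ C * (1 + ‖x‖))
    {u g : E → ℝ → ℝ}
    (hu_cont : ContinuousOn (fun q : E × ℝ => u q.1 q.2) (univ ×ˢ Ici (0 : ℝ)))
    (hu_x : ∀ t : ℝ, 0 < t → ContDiff ℝ 2 (fun x => u x t))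
    (hu_t : ∀ x, ContDiffOn ℝ 1 (fun s => u x s) (Ioi (0 : ℝ)))
    (hpde : ∀ x t, 0 < t →
      deriv (fun s => u x s) t =
        (1 / 2) * ∑ i, ∑ j, a i j x * pd i (pd j (fun y => u y t)) x
          + ∑ i, b i x * pd i (fun y => u y t) x + g x t)
    {ρ T K S : ℝ} (hρS : ρ ^ 2 < S) {F F1 F2 : ℝ → ℝ}
    (hF : ∀ s < S, HasDerivAt F (F1 s) s) (hF1 : ∀ s < S, HasDerivAt F1 (F2 s) s)
    (hF1_nonneg : ∀ s < S, 0 ≤ F1 s) (hF2_nonneg : ∀ s < S, 0 ≤ F2 s)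
    (hinit : ∀ x, ‖x‖ ≤ ρ → u x 0 ≤ F (‖x‖ ^ 2))
    (hbdry : ∀ x t, ‖x‖ = ρ → 0 ≤ t → t ≤ T → u x t ≤ Real.exp (K * t) * F (‖x‖ ^ 2))
    (hsuper : ∀ x t, 0 < t → t ≤ T → ‖x‖ < ρ → Real.exp (K * t) * F (‖x‖ ^ 2) < u x t →
      Real.exp (K * t) * (2 * F2 (‖x‖ ^ 2) * (C * ‖x‖ ^ 2 * (1 + ‖x‖ ^ 2)) +
        F1 (‖x‖ ^ 2) * (C * (d + 4) * (1 + ‖x‖ ^ 2))) + g x t < K * u x t) :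
    ∀ x t, ‖x‖ ≤ ρ → 0 ≤ t → t ≤ T → u x t ≤ Real.exp (K * t) * F (‖x‖ ^ 2) := by
  intro x t hx ht htT
  have hlt {y : E} (hy : ‖y‖ ≤ ρ) : ‖y‖ ^ 2 < S :=
    (pow_le_pow_left₀ (norm_nonneg y) hy 2).trans_lt hρS
  let v : E × ℝ → ℝ := fun q => u q.1 q.2 * Real.exp (-(K * q.2)) - F (‖q.1‖ ^ 2)
  have hcompact : IsCompact (Metric.closedBall (0 : E) ρ ×ˢ Icc (0 : ℝ) T) :=
    (isCompact_closedBall _ _).prod isCompact_Icc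
  have hv : ContinuousOn v (Metric.closedBall (0 : E) ρ ×ˢ Icc (0 : ℝ) T) := by
    refine ((hu_cont.mono (prod_mono (subset_univ _) fun s hs => hs.1)).mul
      (by fun_prop)).sub ?_
    have hFc : ContinuousOn F (Iio S) := fun s hs => (hF s hs).continuousAt.continuousWithinAt
    refine hFc.comp (by fun_prop) fun q hq => hlt (by simpa using hq.1)
  obtain ⟨⟨x₀, t₀⟩, hmem, hmax⟩ := hcompact.exists_isMaxOn
    ⟨(x, t), by simpa using hx, ht, htT⟩ hv
  have hmax' (y : E) (s : ℝ) (hy : ‖y‖ ≤ ρ) (hs : 0 ≤ s) (hsT : s ≤ T) :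
      u y s * Real.exp (-(K * s)) - F (‖y‖ ^ 2) ≤
        u x₀ t₀ * Real.exp (-(K * t₀)) - F (‖x₀‖ ^ 2) :=
    hmax (show (y, s) ∈ _ from ⟨by simpa using hy, hs, hsT⟩)
  have hx₀ : ‖x₀‖ ≤ ρ := by simpa using hmem.1
  have ht₀ : 0 ≤ t₀ := hmem.2.1
  have ht₀T : t₀ ≤ T := hmem.2.2
  have hiff (y : E) (s : ℝ) : u y s ≤ Real.exp (K * s) * F (‖y‖ ^ 2) ↔
      u y s * Real.exp (-(K * s)) - F (‖y‖ ^ 2) ≤ 0 := by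
    rw [Real.exp_neg, ← div_eq_mul_inv, sub_nonpos, div_le_iff₀' (Real.exp_pos _)]
  rw [hiff]
  refine (hmax' x t hx ht htT).trans ?_
  rw [← hiff]
  by_contra! hgt
  have ht₀_pos : 0 < t₀ := by
    refine ht₀.lt_of_ne fun h => ?_
    subst h
    simp only [mul_zero, Real.exp_zero, one_mul] at hgt
    exact absurd (hinit x₀ hx₀) (not_le.2 hgt)
  have hx₀_lt : ‖x₀‖ < ρ := hx₀.lt_of_ne fun h => (hbdry x₀ t₀ h ht₀ ht₀T).not_gt hgt
  have hderiv : HasDerivAt (fun s => u x₀ s) (deriv (fun s => u x₀ s) t₀) t₀ :=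
    (((hu_t x₀).differentiableOn (by norm_num)).differentiableAt
      (Ioi_mem_nhds ht₀_pos)).hasDerivAt
  have hexp : HasDerivAt (fun s : ℝ => Real.exp (-(K * s)))
      (Real.exp (-(K * t₀)) * -K) t₀ := by
    simpa using ((hasDerivAt_id t₀).const_mul K).neg.exp
  have htime : K * u x₀ t₀ ≤ deriv (fun s => u x₀ s) t₀ := by
    have h := deriv_nonneg_of_left_le ht₀_pos (hderiv.mul hexp) fun s hs hst => by
      have := hmax' x₀ s hx₀ hs.le (hst.le.trans ht₀T)
      simpa using this
    have h' : 0 ≤ Real.exp (-(K * t₀)) * (deriv (fun s => u x₀ s) t₀ - K * u x₀ t₀) := by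
      linarith
    linarith [nonneg_of_mul_nonneg_right h' (Real.exp_pos _)]
  have hlocal : IsLocalMax
      (fun y => u y t₀ - (fun s => Real.exp (K * t₀) * F s) (‖y‖ ^ 2)) x₀ := by
    have hball : ∀ᶠ y in 𝓝 x₀, ‖y‖ < ρ := continuous_norm.continuousAt.eventually_lt_const hx₀_lt
    filter_upwards [hball] with y hy
    have h := mul_le_mul_of_nonneg_left (hmax' y t₀ hy.le ht₀ ht₀T) (Real.exp_pos (K * t₀)).le
    have he : Real.exp (K * t₀) * Real.exp (-(K * t₀)) = 1 := by
      rw [← Real.exp_add]; simp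
    have e (z : ℝ) : Real.exp (K * t₀) * (z * Real.exp (-(K * t₀))) = z := by
      rw [mul_left_comm, he, mul_one]
    simpa only [mul_sub, e] using h
  have hEpos := Real.exp_pos (K * t₀)
  have hell := elliptic_le_of_growth (hu_x t₀ ht₀_pos)
    (F1 := fun s => Real.exp (K * t₀) * F1 s)
    ((eventually_lt_nhds (hlt hx₀)).mono fun s hs => (hF s hs).const_mul _)
    ((hF1 _ (hlt hx₀)).const_mul (Real.exp (K * t₀)))
    (mul_nonneg hEpos.le (hF1_nonneg _ (hlt hx₀)))
    (mul_nonneg hEpos.le (hF2_nonneg _ (hlt hx₀))) hlocal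
    (fun i j => ha_symm i j x₀) (ha_pos x₀) hC (ha_bound x₀) (hb_bound x₀)
  have hs := hsuper x₀ t₀ ht₀_pos ht₀T hx₀_lt hgt
  rw [hpde x₀ t₀ ht₀_pos] at htime
  linarith


theorem hasDerivAt_inv_one_sub_div {R s : ℝ} (hR : 0 < R) (hs : s < R ^ 2) :
    HasDerivAt (fun s => (1 - s / R ^ 2)⁻¹) ((1 - s / R ^ 2)⁻¹ ^ 2 / R ^ 2) s := by
  have hpos : 0 < 1 - s / R ^ 2 := by
    rw [sub_pos, div_lt_one (by positivity)]
    exact hs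
  have h := (((hasDerivAt_id' s).div_const (R ^ 2)).const_sub 1).inv hpos.ne'
  refine h.congr_deriv ?_
  rw [neg_neg, inv_pow]
  ring

theorem hasDerivAt_inv_one_sub_div_pow {R s : ℝ} (hR : 0 < R) (hs : s < R ^ 2) (c : ℝ) (k : ℕ) :
    HasDerivAt (fun s => c * (1 - s / R ^ 2)⁻¹ ^ (k + 1))
      (c * (k + 1) / R ^ 2 * (1 - s / R ^ 2)⁻¹ ^ (k + 2)) s := by
  refine (((hasDerivAt_inv_one_sub_div hR hs).pow (k + 1)).const_mul c).congr_deriv ?_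
  push_cast
  ring

/-- Keller–Osserman estimate: the blow-up barrier dominates on every ball of radius `R ≥ 1`. -/
theorem le_blowup_barrier {a : Fin d → Fin d → E → ℝ} {b : Fin d → E → ℝ}
    (ha_symm : ∀ i j x, a i j x = a j i x)
    (ha_pos : ∀ x ν : E, 0 ≤ ∑ i, ∑ j, a i j x * ν i * ν j) {C : ℝ} (hC : 0 < C)
    (ha_bound : ∀ x ν : E, ∑ i, ∑ j, a i j x * ν i * ν j ≤ C * ‖ν‖ ^ 2 * (1 + ‖x‖ ^ 2))
    (hb_bound : ∀ x : E, Real.sqrt (∑ i, (b i x) ^ 2) ≤ C * (1 + ‖x‖))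
    {p : ℝ} (hp : 1 < p) {α β : E → ℝ} {ε M : ℝ} (hε : 0 < ε)
    (hα : ∀ x, ε ≤ α x) (hβ : ∀ x, β x ≤ M) {u : E → ℝ → ℝ}
    (hu_cont : ContinuousOn (fun q : E × ℝ => u q.1 q.2) (univ ×ˢ Ici (0 : ℝ)))
    (hu_x : ∀ t : ℝ, 0 < t → ContDiff ℝ 2 (fun x => u x t))
    (hu_t : ∀ x, ContDiffOn ℝ 1 (fun s => u x s) (Ioi (0 : ℝ)))
    (hpde : ∀ x t, 0 < t →
      deriv (fun s => u x s) t =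
        (1 / 2) * ∑ i, ∑ j, a i j x * pd i (pd j (fun y => u y t)) x
          + ∑ i, b i x * pd i (fun y => u y t) x + (β x * u x t - α x * u x t ^ p))
    (hinit : ∀ x, u x 0 = 0) {k : ℕ} (hk : 2 ≤ (k + 1) * (p - 1)) {A : ℝ} (hA : 0 < A)
    (hAlarge : 4 * C * (k + 1) * (k + 2) + 2 * C * (d + 4) * (k + 1) + |M| < ε * A ^ (p - 1))
    {R : ℝ} (hR : 1 ≤ R) {x : E} (hx : ‖x‖ < R) {t : ℝ} (ht : 0 ≤ t) :
    u x t ≤ A * (1 - ‖x‖ ^ 2 / R ^ 2)⁻¹ ^ (k + 1) := by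
  have hR0 : 0 < R := by linarith
  have hw {s : ℝ} (hs : s < R ^ 2) : 0 < 1 - s / R ^ 2 := by
    rw [sub_pos, div_lt_one (by positivity)]
    exact hs
  have hxR : ‖x‖ ^ 2 < R ^ 2 := by gcongr
  have hcompact : IsCompact (Metric.closedBall (0 : E) R ×ˢ Icc (0 : ℝ) t) :=
    (isCompact_closedBall _ _).prod isCompact_Icc
  obtain ⟨B, hB⟩ := hcompact.bddAbove_image
    (hu_cont.mono (prod_mono (subset_univ _) fun s hs => hs.1))
  set θ := min (A / (|B| + 1)) (1 - ‖x‖ ^ 2 / R ^ 2) with hθ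
  have hθ_pos : 0 < θ := lt_min (by positivity) (hw hxR)
  have hθ_le : θ ≤ 1 - ‖x‖ ^ 2 / R ^ 2 := min_le_right _ _
  have hθ_one : θ ≤ 1 := hθ_le.trans (by linarith [show 0 ≤ ‖x‖ ^ 2 / R ^ 2 by positivity])
  set ρ := Real.sqrt (R ^ 2 * (1 - θ)) with hρ
  have hρsq : ρ ^ 2 = R ^ 2 * (1 - θ) :=
    Real.sq_sqrt (mul_nonneg (sq_nonneg R) (by linarith))
  have hρw : 1 - ρ ^ 2 / R ^ 2 = θ := by
    rw [hρsq]; field_simp; ring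
  have hρR : ρ ^ 2 < R ^ 2 := by
    rw [hρsq]; nlinarith [sq_pos_of_pos hR0]
  have hρR' : ρ ≤ R := (sq_le_sq₀ (Real.sqrt_nonneg _) hR0.le).1 hρR.le
  have hxρ : ‖x‖ ≤ ρ := by
    apply Real.le_sqrt_of_sq_le
    have : ‖x‖ ^ 2 / R ^ 2 ≤ 1 - θ := by linarith
    rw [div_le_iff₀ (by positivity)] at this
    linarith
  have key := le_radial_barrier ha_symm ha_pos hC ha_bound hb_bound hu_cont hu_x hu_t hpde
    (T := t) (K := 0) hρR
    (fun s hs => hasDerivAt_inv_one_sub_div_pow hR0 hs A k)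
    (fun s hs => hasDerivAt_inv_one_sub_div_pow hR0 hs (A * (k + 1) / R ^ 2) (k + 1))
    (fun s hs => by have := hw hs; positivity)
    (fun s hs => by have := hw hs; positivity)
    (fun y hy => by
      have hy' : ‖y‖ ^ 2 < R ^ 2 := (pow_le_pow_left₀ (norm_nonneg y) hy 2).trans_lt hρR
      have := hw hy'
      rw [hinit]; positivity)
    (fun y s hy hs hst => by
      have h1 : u y s ≤ B :=
        hB ⟨(y, s), ⟨by simpa using hy.le.trans hρR', hs, hst⟩, rfl⟩
      have h2 : |B| + 1 ≤ A * θ⁻¹ := by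
        have : θ ≤ A / (|B| + 1) := min_le_left _ _
        rw [le_div_iff₀ (by positivity)] at this
        rw [← div_eq_mul_inv, le_div_iff₀ hθ_pos]
        linarith
      have h3 : θ⁻¹ ≤ θ⁻¹ ^ (k + 1) :=
        le_self_pow₀ ((one_le_inv₀ hθ_pos).2 hθ_one) (by omega)
      rw [zero_mul, Real.exp_zero, one_mul, hy, hρw]
      calc u y s ≤ |B| + 1 := by linarith [le_abs_self B]
        _ ≤ A * θ⁻¹ := h2
        _ ≤ _ := by gcongr)
    (fun y s hs hst hy hgt => by
      have hyR : ‖y‖ ^ 2 < R ^ 2 :=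
        (pow_le_pow_left₀ (norm_nonneg y) hy.le 2).trans_lt hρR
      have hwy := hw hyR
      rw [zero_mul, Real.exp_zero, one_mul] at hgt ⊢
      rw [zero_mul]
      set z := (1 - ‖y‖ ^ 2 / R ^ 2)⁻¹ with hz
      have hz1 : 1 ≤ z :=
        (one_le_inv₀ hwy).2 (by linarith [show 0 ≤ ‖y‖ ^ 2 / R ^ 2 by positivity])
      have hz0 : 0 < z := by linarith
      have hupos : 0 < u y s := lt_trans (by positivity) hgt
      have hR2 : 1 ≤ R ^ 2 := one_le_pow₀ hR
      have hq1 : (1 + ‖y‖ ^ 2) / R ^ 2 ≤ 2 := by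
        rw [div_le_iff₀ (by positivity)]; linarith
      have hq2 : ‖y‖ ^ 2 / R ^ 2 ≤ 1 := by
        rw [div_le_iff₀ (by positivity)]; linarith
      have hdiff : 2 * (A * (k + 1) / R ^ 2 * (((k + 1 : ℕ) : ℝ) + 1) / R ^ 2 * z ^ (k + 1 + 2)) *
            (C * ‖y‖ ^ 2 * (1 + ‖y‖ ^ 2)) +
          A * (k + 1) / R ^ 2 * z ^ (k + 2) * (C * (d + 4) * (1 + ‖y‖ ^ 2)) ≤
          A * z ^ (k + 1) * z ^ 2 *
            (4 * C * (k + 1) * (k + 2) + 2 * C * (d + 4) * (k + 1)) := by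
        have e1 : 2 * (A * (k + 1) / R ^ 2 * (((k + 1 : ℕ) : ℝ) + 1) / R ^ 2 * z ^ (k + 1 + 2)) *
            (C * ‖y‖ ^ 2 * (1 + ‖y‖ ^ 2)) = A * z ^ (k + 1) * z ^ 2 *
            (2 * C * (k + 1) * (k + 2) * ((‖y‖ ^ 2 / R ^ 2) * ((1 + ‖y‖ ^ 2) / R ^ 2))) := by
          push_cast; ring
        have e2 : A * (k + 1) / R ^ 2 * z ^ (k + 2) * (C * (d + 4) * (1 + ‖y‖ ^ 2)) =
            A * z ^ (k + 1) * z * (C * (d + 4) * (k + 1) * ((1 + ‖y‖ ^ 2) / R ^ 2)) := by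
          ring
        have i1 : A * z ^ (k + 1) * z ^ 2 *
            (2 * C * (k + 1) * (k + 2) * ((‖y‖ ^ 2 / R ^ 2) * ((1 + ‖y‖ ^ 2) / R ^ 2))) ≤
            A * z ^ (k + 1) * z ^ 2 * (2 * C * (k + 1) * (k + 2) * (1 * 2)) := by
          gcongr
        have i2 : A * z ^ (k + 1) * z * (C * (d + 4) * (k + 1) * ((1 + ‖y‖ ^ 2) / R ^ 2)) ≤
            A * z ^ (k + 1) * z ^ 2 * (C * (d + 4) * (k + 1) * 2) := by
          gcongr
          exact le_self_pow₀ hz1 (by norm_num)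
        rw [e1, e2]
        linarith
      have hreact : ε * (A ^ (p - 1) * z ^ 2) * u y s ≤ α y * u y s ^ p := by
        have h1 : u y s ^ p = u y s ^ (p - 1) * u y s := by
          rw [← Real.rpow_add_one hupos.ne']; congr 1; ring
        have h2 : A ^ (p - 1) * z ^ 2 ≤ u y s ^ (p - 1) := by
          calc A ^ (p - 1) * z ^ 2 ≤ A ^ (p - 1) * (z ^ (k + 1)) ^ (p - 1) := by
                gcongr
                rw [← Real.rpow_natCast z (k + 1), ← Real.rpow_mul hz0.le, ← Real.rpow_natCast z 2]
                exact Real.rpow_le_rpow_of_exponent_le hz1 (by push_cast; exact hk)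
            _ = (A * z ^ (k + 1)) ^ (p - 1) := (Real.mul_rpow hA.le (by positivity)).symm
            _ ≤ u y s ^ (p - 1) :=
                Real.rpow_le_rpow (by positivity) hgt.le (by linarith)
        rw [h1, ← mul_assoc (α y)]
        exact mul_le_mul_of_nonneg_right
          (mul_le_mul (hα y) h2 (by positivity) (hε.le.trans (hα y))) hupos.le
      have hgrowth : β y * u y s ≤ |M| * z ^ 2 * u y s := by
        gcongr
        calc β y ≤ |M| := (hβ y).trans (le_abs_self M)
          _ ≤ |M| * z ^ 2 := le_mul_of_one_le_right (abs_nonneg M) (one_le_pow₀ hz1)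
      set Q := 4 * C * (k + 1) * (k + 2) + 2 * C * (d + 4) * (k + 1) with hQ
      have hQ0 : 0 ≤ Q := by positivity
      have hdiff' : A * z ^ (k + 1) * z ^ 2 * Q ≤ u y s * z ^ 2 * Q := by gcongr
      have hfinal : (Q + |M|) * (u y s * z ^ 2) < ε * A ^ (p - 1) * (u y s * z ^ 2) := by
        gcongr
      linarith)
  simpa using key x t hxρ ht le_rfl

end

/-- under Assumption 1 and `inf α > 0`, the only nonnegative classical
solution of `u_t = Lu + βu − αu^p` with zero initial data is `u ≡ 0`. -/
theorem stmt_1 {d : ℕ} (hd : 1 ≤ d) (p : ℝ) (hp1 : 1 < p) (hp2 : p ≤ 2)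
    (a : Fin d → Fin d → EuclideanSpace ℝ (Fin d) → ℝ)
    (b : Fin d → EuclideanSpace ℝ (Fin d) → ℝ)
    (ha_holder : ∀ i j, LocHolder (a i j))
    (hb_holder : ∀ i, LocHolder (b i))
    (ha_symm : ∀ i j x, a i j x = a j i x)
    (ha_ell : ∀ (x ν : EuclideanSpace ℝ (Fin d)), ν ≠ 0 →
      0 < ∑ i, ∑ j, a i j x * ν i * ν j)
    (C : ℝ) (hC : 0 < C)
    (ha_bound : ∀ (x ν : EuclideanSpace ℝ (Fin d)),
      ∑ i, ∑ j, a i j x * ν i * ν j ≤ C * ‖ν‖ ^ 2 * (1 + ‖x‖ ^ 2))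
    (hb_bound : ∀ x : EuclideanSpace ℝ (Fin d),
      Real.sqrt (∑ i, (b i x) ^ 2) ≤ C * (1 + ‖x‖))
    (α β : EuclideanSpace ℝ (Fin d) → ℝ)
    (hα_holder : LocHolder α) (hβ_holder : LocHolder β)
    (hα_inf : ∃ ε : ℝ, 0 < ε ∧ ∀ x, ε ≤ α x)
    (hβ_bdd : ∃ M : ℝ, ∀ x, β x ≤ M)
    (u : EuclideanSpace ℝ (Fin d) → ℝ → ℝ)
    (hu_cont : ContinuousOn (fun q : EuclideanSpace ℝ (Fin d) × ℝ => u q.1 q.2)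
      (univ ×ˢ Ici (0 : ℝ)))
    (hu_nonneg : ∀ x t, 0 ≤ t → 0 ≤ u x t)
    (hu_x : ∀ t : ℝ, 0 < t → ContDiff ℝ 2 (fun x => u x t))
    (hu_t : ∀ x, ContDiffOn ℝ 1 (fun s => u x s) (Ioi (0 : ℝ)))
    (hpde : ∀ x t, 0 < t →
      deriv (fun s => u x s) t =
        (1 / 2) * ∑ i, ∑ j, a i j x * pd i (pd j (fun y => u y t)) x
          + ∑ i, b i x * pd i (fun y => u y t) x
          + β x * u x t - α x * u x t ^ p)
    (hinit : ∀ x, u x 0 = 0) :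
    ∀ x t, 0 ≤ t → u x t = 0 := by
  have ha_pos : ∀ x ν : EuclideanSpace ℝ (Fin d), 0 ≤ ∑ i, ∑ j, a i j x * ν i * ν j := by
    intro x ν
    rcases eq_or_ne ν 0 with rfl | hν
    · simp
    · exact (ha_ell x ν hν).le
  obtain ⟨ε, hε, hα⟩ := hα_inf
  obtain ⟨M, hβ⟩ := hβ_bdd
  have hpde' : ∀ x t, 0 < t →
      deriv (fun s => u x s) t =
        (1 / 2) * ∑ i, ∑ j, a i j x * pd i (pd j (fun y => u y t)) x
          + ∑ i, b i x * pd i (fun y => u y t) x + (β x * u x t - α x * u x t ^ p) := by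
    intro x t ht
    rw [hpde x t ht]
    ring
  obtain ⟨k, hk⟩ := exists_nat_ge (2 / (p - 1))
  have hk' : 2 ≤ ((k : ℝ) + 1) * (p - 1) := by
    rw [div_le_iff₀ (by linarith)] at hk
    linarith
  obtain ⟨A, hA, hAlarge⟩ : ∃ A : ℝ, 0 < A ∧
      4 * C * (k + 1) * (k + 2) + 2 * C * (d + 4) * (k + 1) + |M| < ε * A ^ (p - 1) := by
    have h := (tendsto_rpow_atTop (show 0 < p - 1 by linarith)).const_mul_atTop hε
    exact ((eventually_gt_atTop 0).and (h.eventually_gt_atTop _)).exists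
  have hbound : ∀ x t, 0 ≤ t → u x t ≤ A := by
    intro x t ht
    have hlim : Tendsto (fun R : ℝ => A * (1 - ‖x‖ ^ 2 / R ^ 2)⁻¹ ^ (k + 1)) atTop (𝓝 A) := by
      have h1 : Tendsto (fun R : ℝ => ‖x‖ ^ 2 / R ^ 2) atTop (𝓝 0) :=
        (tendsto_pow_atTop (by norm_num)).const_div_atTop _
      simpa using (((h1.const_sub 1).inv₀ (by norm_num)).pow (k + 1)).const_mul A
    refine ge_of_tendsto hlim ?_
    filter_upwards [eventually_ge_atTop 1, eventually_gt_atTop ‖x‖] with R hR hxR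
    exact le_blowup_barrier ha_symm ha_pos hC ha_bound hb_bound hp1 hε hα hβ hu_cont hu_x hu_t
      hpde' hinit hk' hA hAlarge hR hxR ht
  intro x t ht
  refine le_antisymm ?_ (hu_nonneg x t ht)
  set K := C * (d + 4) + |M| with hK
  have hK0 : 0 ≤ K := by positivity
  have hδ : ∀ δ : ℝ, 0 < δ → u x t ≤ Real.exp (K * t) * (δ * (1 + ‖x‖ ^ 2)) := by
    intro δ hδ
    set ρ := max ‖x‖ (Real.sqrt (A / δ)) with hρ
    have hρA : A ≤ δ * (1 + ρ ^ 2) := by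
      have h1 : A / δ ≤ ρ ^ 2 := (Real.sqrt_le_iff.1 (le_max_right _ _)).2
      rw [div_le_iff₀ hδ] at h1
      linarith
    refine le_radial_barrier ha_symm ha_pos hC ha_bound hb_bound hu_cont hu_x hu_t hpde'
      (T := t) (ρ := ρ) (S := ρ ^ 2 + 1) (F := fun s => δ * (1 + s)) (F1 := fun _ => δ)
      (F2 := fun _ => 0) (lt_add_one _)
      (fun s _ => by simpa using ((hasDerivAt_id' s).const_add 1).const_mul δ)
      (fun s _ => hasDerivAt_const s δ) (fun _ _ => hδ.le) (fun _ _ => le_rfl)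
      (fun y _ => by rw [hinit]; positivity) (fun y s hy hs _ => ?_) (fun y s hs _ _ hgt => ?_)
      x t (le_max_left _ _) ht le_rfl
    · rw [hy]
      exact ((hbound y s hs).trans hρA).trans
        (le_mul_of_one_le_left (by positivity) (Real.one_le_exp (by positivity)))
    · have hu := hu_nonneg y s hs.le
      have hreact : 0 ≤ α y * u y s ^ p :=
        mul_nonneg (hε.le.trans (hα y)) (Real.rpow_nonneg hu p)
      have hgrowth : β y * u y s ≤ |M| * u y s :=
        mul_le_mul_of_nonneg_right ((hβ y).trans (le_abs_self M)) hu
      have hcd : 0 < C * ((d : ℝ) + 4) := by positivity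
      have := mul_lt_mul_of_pos_left hgt hcd
      rw [hK]
      linarith
  have hlim : Tendsto (fun δ : ℝ => Real.exp (K * t) * (δ * (1 + ‖x‖ ^ 2))) (𝓝[>] 0) (𝓝 0) := by
    have h : Continuous fun δ : ℝ => Real.exp (K * t) * (δ * (1 + ‖x‖ ^ 2)) := by fun_prop
    simpa using h.continuousWithinAt.tendsto (s := Ioi 0) (x := 0)
  exact ge_of_tendsto hlim (eventually_mem_nhdsWithin.mono hδ)
end

section
/- Let d ≥ 1, p ∈ (1,2], m ∈ [0,2], and let A : ℝ^d → ℝ be locally Hölder continuous with C₀^{-1}(1+|x|)^m ≤ A(x) ≤ C₀(1+|x|)^m for all x and some C₀ > 0. Let α, β : ℝ^d → ℝ be locally Hölder continuous with α > 0, β bounded from above, and suppose α(x) ≥ C₁ exp(−C₂|x|^{2−m}) for all x, for some C₁, C₂ > 0. Then the only function u : ℝ^d × [0,∞) → ℝ that is continuous, nonnegative, twice continuously differentiable in x and once in t on ℝ^d × (0,∞), satisfies ∂u/∂t = A(x)Δu + β(x)u − α(x)u^p on ℝ^d × (0,∞), and satisfies u(x,0) = 0 for all x ∈ ℝ^d,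 is u ≡ 0. -/
open Set

open Filter Topology Metric

theorem nonpos_of_isLocalMax_of_hasDerivAt {g g' : ℝ → ℝ} {c : ℝ} (hmax : IsLocalMax g 0)
    (hg : ∀ᶠ s in 𝓝 0, HasDerivAt g (g' s) s) (hg' : HasDerivAt g' c 0) : c ≤ 0 := by
  by_contra! hc
  have h1 : deriv g =ᶠ[𝓝 0] g' := hg.mono fun s hs => hs.deriv
  have h2 : deriv (deriv g) 0 = c := h1.deriv_eq.trans hg'.deriv
  have hmin : IsLocalMin g 0 := isLocalMin_of_deriv_deriv_pos (h2 ▸ hc) hmax.deriv_eq_zero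
    hg.self_of_nhds.continuousAt
  have h3 : g =ᶠ[𝓝 0] fun _ => g 0 := by
    filter_upwards [hmax, hmin] with s ha hb using le_antisymm ha hb
  have h4 : deriv (deriv g) 0 = 0 := by
    rw [h3.deriv.deriv_eq]
    simp
  linarith

theorem nonneg_of_hasDerivAt_of_forall_le {f : ℝ → ℝ} {c t : ℝ} (ht : 0 < t)
    (hf : HasDerivAt f c t) (hmax : ∀ s ∈ Icc 0 t, f s ≤ f t) : 0 ≤ c := by
  have h := (hasDerivWithinAt_iff_tendsto_slope' (s := Iio t) (by simp)).1 hf.hasDerivWithinAt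
  refine ge_of_tendsto h ?_
  filter_upwards [Ioo_mem_nhdsLT ht] with s hs
  rw [slope_def_field]
  exact div_nonneg_of_nonpos (by linarith [hmax s ⟨hs.1.le, hs.2.le⟩]) (by linarith [hs.2])

theorem one_add_rpow_le {r e : ℝ} (hr : 0 ≤ r) (he0 : 0 ≤ e) (he2 : e ≤ 2) :
    (1 + r) ^ e ≤ 2 * (1 + r ^ 2) ^ (e / 2) := by
  calc (1 + r) ^ e = ((1 + r) ^ 2) ^ (e / 2) := by
        rw [← Real.rpow_natCast_mul (by positivity)]
        congr 1
        push_cast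
        ring
    _ ≤ (2 * (1 + r ^ 2)) ^ (e / 2) :=
        Real.rpow_le_rpow (by positivity) (by nlinarith [sq_nonneg (r - 1)]) (by positivity)
    _ = 2 ^ (e / 2) * (1 + r ^ 2) ^ (e / 2) := Real.mul_rpow (by norm_num) (by positivity)
    _ ≤ 2 * (1 + r ^ 2) ^ (e / 2) := by
        gcongr
        calc (2 : ℝ) ^ (e / 2) ≤ 2 ^ (1 : ℝ) :=
              Real.rpow_le_rpow_of_exponent_le (by norm_num) (by linarith)
          _ = 2 := Real.rpow_one 2

/-- Algebraic form of the inequality making `exp (k log s + g s ^ q)`, with `s = 1 + ‖x‖²`, a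
supersolution of the linear equation. -/
theorem barrier_inequality {a C₀ s q k g G lam b : ℝ} (hs : 1 ≤ s) (hq0 : 0 ≤ q)
    (hq1 : q ≤ 1) (hk : 0 ≤ k) (hg : 0 ≤ g) (hG : k + g ≤ G) (ha0 : 0 ≤ a) (hb : 0 ≤ b)
    (hC₀ : 0 ≤ C₀) (ha : a ≤ 2 * C₀ * s ^ (1 - q))
    (hlam : C₀ * (4 * b * G + 8 * G ^ 2) ≤ lam) :
    a * (2 * b * (k / s + g * (q * s ^ (q - 1)))
      + 4 * (s - 1) * ((k / s + g * (q * s ^ (q - 1))) ^ 2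
        + (-k / s ^ 2 + g * (q * ((q - 1) * s ^ (q - 1 - 1)))))) ≤ lam * s ^ q := by
  have hs0 : 0 < s := by linarith
  have hG0 : 0 ≤ G := by linarith
  obtain ⟨P, hP⟩ : ∃ P, P = s ^ (q - 1) := ⟨_, rfl⟩
  have hP0 : 0 ≤ P := by
    rw [hP]
    positivity
  have hS1 : 1 ≤ s ^ q := Real.one_le_rpow hs hq0
  have hsP : s * P = s ^ q := by
    rw [hP, Real.rpow_sub_one hs0.ne']
    field_simp
  have haP : a * P ≤ 2 * C₀ := by
    calc a * P ≤ 2 * C₀ * s ^ (1 - q) * P := by gcongr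
      _ = 2 * C₀ := by
        rw [hP, mul_assoc, ← Real.rpow_add hs0]
        simp
  have hinv : s⁻¹ ≤ P := by
    rw [hP, ← Real.rpow_neg_one]
    exact Real.rpow_le_rpow_of_exponent_le hs (by linarith)
  have hL2 : -k / s ^ 2 + g * (q * ((q - 1) * s ^ (q - 1 - 1))) ≤ 0 := by
    have e1 : -k / s ^ 2 ≤ 0 := div_nonpos_of_nonpos_of_nonneg (by linarith) (by positivity)
    have e2 : g * (q * ((q - 1) * s ^ (q - 1 - 1))) ≤ 0 :=
      mul_nonpos_of_nonneg_of_nonpos hg (mul_nonpos_of_nonneg_of_nonpos hq0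
        (mul_nonpos_of_nonpos_of_nonneg (by linarith) (by positivity)))
    linarith
  rw [← hP]
  obtain ⟨L, hL⟩ : ∃ L, L = k / s + g * (q * P) := ⟨_, rfl⟩
  rw [← hL]
  have hL0 : 0 ≤ L := by
    rw [hL]
    positivity
  have hLG : L ≤ G * P := by
    calc L = k * s⁻¹ + g * (q * P) := by rw [hL, div_eq_mul_inv]
      _ ≤ k * P + g * (1 * P) := by gcongr
      _ = (k + g) * P := by ring
      _ ≤ G * P := by gcongr
  have haL : a * L ≤ 2 * C₀ * G := by
    calc a * L ≤ a * (G * P) := by gcongr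
      _ = a * P * G := by ring
      _ ≤ 2 * C₀ * G := by gcongr
  have hsL : (s - 1) * L ≤ G * s ^ q := by
    calc (s - 1) * L ≤ s * (G * P) := by
          gcongr
          linarith
      _ = G * s ^ q := by rw [← hsP]; ring
  have hquad : a * L * ((s - 1) * L) ≤ 2 * C₀ * G * (G * s ^ q) := by
    have : 0 ≤ s - 1 := by linarith
    gcongr
  have hlin : a * L * b ≤ 2 * C₀ * G * b * s ^ q :=
    (mul_le_mul_of_nonneg_right haL hb).trans (le_mul_of_one_le_right (by positivity) hS1)
  have hneg : a * (s - 1) * (-k / s ^ 2 + g * (q * ((q - 1) * s ^ (q - 1 - 1)))) ≤ 0 :=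
    mul_nonpos_of_nonneg_of_nonpos (mul_nonneg ha0 (by linarith)) hL2
  have := mul_le_mul_of_nonneg_right hlam (zero_le_one.trans hS1)
  linarith

section

variable {d : ℕ}

theorem hasDerivAt_comp_add_smul_single {f : EuclideanSpace ℝ (Fin d) → ℝ}
    (hf : Differentiable ℝ f) (x : EuclideanSpace ℝ (Fin d)) (i : Fin d) (s : ℝ) :
    HasDerivAt (fun r : ℝ => f (x + r • EuclideanSpace.single i (1 : ℝ)))
      (pd i f (x + s • EuclideanSpace.single i (1 : ℝ))) s := by
  have h : HasDerivAt (fun r : ℝ => x + r • EuclideanSpace.single i (1 : ℝ))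
      (EuclideanSpace.single i (1 : ℝ)) s := by
    simpa using ((hasDerivAt_id s).smul_const (EuclideanSpace.single i (1 : ℝ))).const_add x
  exact (hf _).hasFDerivAt.comp_hasDerivAt s h

theorem differentiable_pd {f : EuclideanSpace ℝ (Fin d) → ℝ} (hf : ContDiff ℝ 2 f) (i : Fin d) :
    Differentiable ℝ (pd i f) := by
  have h : Differentiable ℝ (fderiv ℝ f) :=
    (hf.fderiv_right (m := 1) (by norm_num)).differentiable (by norm_num)
  unfold pd
  fun_prop

theorem pd_const_mul (i : Fin d) (c : ℝ) (f : EuclideanSpace ℝ (Fin d) → ℝ) :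
    pd i (fun y => c * f y) = fun y => c * pd i f y := by
  funext y
  have h : fderiv ℝ (fun y => c * f y) y = c • fderiv ℝ f y := by
    simpa only [Pi.smul_def, smul_eq_mul] using congrFun (fderiv_const_smul_field (f := f) c) y
  simp [pd, h]

theorem norm_add_smul_single_sq (y : EuclideanSpace ℝ (Fin d)) (i : Fin d) (s : ℝ) :
    ‖y + s • EuclideanSpace.single i (1 : ℝ)‖ ^ 2 = ‖y‖ ^ 2 + 2 * y i * s + s ^ 2 := by
  rw [norm_add_sq_real, inner_smul_right, EuclideanSpace.inner_single_right, norm_smul,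
    PiLp.norm_single]
  simp
  ring

/-- At a local maximum of the difference between `f` and a radial function `φ (‖· - x₀‖²)`, the
Laplacian of `f` is at most that of the radial function. -/
theorem laplacian_le_of_isLocalMax_sub_radial {f : EuclideanSpace ℝ (Fin d) → ℝ}
    (hf : ContDiff ℝ 2 f) {x x₀ : EuclideanSpace ℝ (Fin d)} {φ φ₁ : ℝ → ℝ} {c : ℝ}
    (h1 : ∀ᶠ N in 𝓝 (‖x - x₀‖ ^ 2), HasDerivAt φ (φ₁ N) N)
    (h2 : HasDerivAt φ₁ c (‖x - x₀‖ ^ 2))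
    (hmax : IsLocalMax (fun y => f y - φ (‖y - x₀‖ ^ 2)) x) :
    ∑ i, pd i (pd i f) x ≤ 2 * d * φ₁ (‖x - x₀‖ ^ 2) + 4 * ‖x - x₀‖ ^ 2 * c := by
  have key (i : Fin d) :
      pd i (pd i f) x ≤ 2 * φ₁ (‖x - x₀‖ ^ 2) + 4 * (x - x₀) i ^ 2 * c := by
    set e : EuclideanSpace ℝ (Fin d) := EuclideanSpace.single i (1 : ℝ)
    set a := (x - x₀) i
    set n : ℝ → ℝ := fun s => ‖x - x₀‖ ^ 2 + 2 * a * s + s ^ 2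
    have hn (s : ℝ) : ‖x + s • e - x₀‖ ^ 2 = n s := by
      rw [add_sub_right_comm, norm_add_smul_single_sq]
    have hn0 : n 0 = ‖x - x₀‖ ^ 2 := by simp [n]
    have hnd (s : ℝ) : HasDerivAt n (2 * a + 2 * s) s := by
      have := (((hasDerivAt_id s).const_mul (2 * a)).const_add (‖x - x₀‖ ^ 2)).add
        (hasDerivAt_pow 2 s)
      refine this.congr_deriv ?_
      simp
    rw [← hn0] at h1 h2
    have hline : Tendsto (fun s : ℝ => x + s • e) (𝓝 0) (𝓝 x) := by
      have : Continuous fun s : ℝ => x + s • e := by fun_prop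
      simpa using this.tendsto 0
    have hmax' : IsLocalMax (fun s => f (x + s • e) - φ (n s)) 0 := by
      have := hline.eventually hmax
      filter_upwards [this] with s hs
      simpa [hn, hn0] using hs
    have hd1 : ∀ᶠ s in 𝓝 (0 : ℝ), HasDerivAt (fun s => f (x + s • e) - φ (n s))
        (pd i f (x + s • e) - φ₁ (n s) * (2 * a + 2 * s)) s := by
      filter_upwards [(hnd 0).continuousAt.eventually h1] with s hs
      exact (hasDerivAt_comp_add_smul_single (hf.differentiable (by norm_num)) x i s).sub
        (hs.comp s (hnd s))
    have hd2 : HasDerivAt (fun s => pd i f (x + s • e) - φ₁ (n s) * (2 * a + 2 * s))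
        (pd i (pd i f) (x + (0 : ℝ) • e)
          - (c * (2 * a + 2 * 0) * (2 * a + 2 * 0) + φ₁ (n 0) * 2)) 0 := by
      refine (hasDerivAt_comp_add_smul_single (differentiable_pd hf i) x i 0).sub
        ((h2.comp 0 (hnd 0)).mul ?_)
      simpa using ((hasDerivAt_id (0 : ℝ)).const_mul 2).const_add (2 * a)
    have := nonpos_of_isLocalMax_of_hasDerivAt hmax' hd1 hd2
    rw [hn0, zero_smul, add_zero] at this
    linarith
  calc ∑ i, pd i (pd i f) x
      ≤ ∑ i, (2 * φ₁ (‖x - x₀‖ ^ 2) + 4 * (x - x₀) i ^ 2 * c) := Finset.sum_le_sum fun i _ => key i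
    _ = 2 * d * φ₁ (‖x - x₀‖ ^ 2) + 4 * ‖x - x₀‖ ^ 2 * c := by
      simp only [EuclideanSpace.norm_sq_eq, Real.norm_eq_abs, sq_abs, Finset.sum_add_distrib,
        ← Finset.sum_mul, ← Finset.mul_sum, Finset.sum_const, Finset.card_univ, Fintype.card_fin,
        nsmul_eq_mul]
      ring

/-- `v` is a nonnegative classical subsolution of `v_t = A Δv - v - α v ^ p` with zero initial
data. -/
structure IsNonnegSubsolution (A α : EuclideanSpace ℝ (Fin d) → ℝ) (p : ℝ)
    (v : EuclideanSpace ℝ (Fin d) → ℝ → ℝ) : Prop where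
  cont : ContinuousOn (fun q : EuclideanSpace ℝ (Fin d) × ℝ => v q.1 q.2) (univ ×ˢ Ici (0 : ℝ))
  nonneg : ∀ x t, 0 ≤ t → 0 ≤ v x t
  contDiff : ∀ t : ℝ, 0 < t → ContDiff ℝ 2 fun x => v x t
  ineq : ∀ x t, 0 < t → ∃ c, HasDerivAt (v x) c t ∧
    c ≤ A x * (∑ i, pd i (pd i fun y => v y t) x) - v x t - α x * v x t ^ p
  init : ∀ x, v x 0 = 0

namespace IsNonnegSubsolution

variable {A α : EuclideanSpace ℝ (Fin d) → ℝ} {p : ℝ} {v : EuclideanSpace ℝ (Fin d) → ℝ → ℝ}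

/-- Comparison on a cylinder over a ball with a radial supersolution. -/
theorem le_radial (hv : IsNonnegSubsolution A α p v) (hA : ∀ x, 0 ≤ A x) (hα : ∀ x, 0 ≤ α x)
    (hp : 0 ≤ p) {x₀ : EuclideanSpace ℝ (Fin d)} {R T : ℝ} {U : Set ℝ} (hU : IsOpen U)
    (hUR : Icc 0 (R ^ 2) ⊆ U)
    {φ φ₁ φ₂ φt : ℝ → ℝ → ℝ}
    (hcont : ContinuousOn (fun q : ℝ × ℝ => φ q.1 q.2) (U ×ˢ Icc 0 T))
    (hnonneg : ∀ N ∈ U, ∀ t ∈ Icc 0 T, 0 ≤ φ N t)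
    (h1 : ∀ N ∈ U, ∀ t ∈ Ioc 0 T, HasDerivAt (fun N => φ N t) (φ₁ N t) N)
    (h2 : ∀ N ∈ U, ∀ t ∈ Ioc 0 T, HasDerivAt (fun N => φ₁ N t) (φ₂ N t) N)
    (ht : ∀ N ∈ U, ∀ t ∈ Ioc 0 T, HasDerivAt (φ N) (φt N t) t)
    (hsuper : ∀ x ∈ ball x₀ R, ∀ t ∈ Ioc 0 T,
      A x * (2 * d * φ₁ (‖x - x₀‖ ^ 2) t + 4 * ‖x - x₀‖ ^ 2 * φ₂ (‖x - x₀‖ ^ 2) t)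
        - α x * φ (‖x - x₀‖ ^ 2) t ^ p ≤ φt (‖x - x₀‖ ^ 2) t)
    (hbd : ∀ x ∈ sphere x₀ R, ∀ t ∈ Icc 0 T, v x t ≤ φ (R ^ 2) t)
    {x : EuclideanSpace ℝ (Fin d)} (hx : x ∈ closedBall x₀ R) {t : ℝ} (htT : t ∈ Icc 0 T) :
    v x t ≤ φ (‖x - x₀‖ ^ 2) t := by
  have hmem {y : EuclideanSpace ℝ (Fin d)} (hy : y ∈ closedBall x₀ R) : ‖y - x₀‖ ^ 2 ∈ U :=
    hUR ⟨by positivity, by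
      rw [mem_closedBall, dist_eq_norm] at hy
      exact pow_le_pow_left₀ (norm_nonneg _) hy 2⟩
  have hcomp : IsCompact (closedBall x₀ R ×ˢ Icc (0 : ℝ) T) :=
    (isCompact_closedBall x₀ R).prod isCompact_Icc
  have hz : ContinuousOn (fun q : EuclideanSpace ℝ (Fin d) × ℝ =>
      v q.1 q.2 - φ (‖q.1 - x₀‖ ^ 2) q.2)
      (closedBall x₀ R ×ˢ Icc (0 : ℝ) T) := by
    refine (hv.cont.mono (prod_mono (subset_univ _) Icc_subset_Ici_self)).sub ?_
    refine hcont.comp (f := fun q : EuclideanSpace ℝ (Fin d) × ℝ => (‖q.1 - x₀‖ ^ 2, q.2))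
      (by fun_prop) ?_
    rintro ⟨y, s⟩ ⟨hy, hs⟩
    exact ⟨hmem hy, hs⟩
  obtain ⟨⟨y, s⟩, ⟨hy, hs⟩, hmax⟩ := hcomp.exists_isMaxOn ⟨(x, t), hx, htT⟩ hz
  replace hy : y ∈ closedBall x₀ R := hy
  replace hs : s ∈ Icc 0 T := hs
  have hle (a : EuclideanSpace ℝ (Fin d)) (ha : a ∈ closedBall x₀ R) (b : ℝ) (hb : b ∈ Icc 0 T) :
      v a b - φ (‖a - x₀‖ ^ 2) b ≤ v y s - φ (‖y - x₀‖ ^ 2) s := hmax (a := (a, b)) ⟨ha, hb⟩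
  by_contra! hlt
  have hpos : φ (‖y - x₀‖ ^ 2) s < v y s := by linarith [hle x hx t htT]
  have hφ0 := hnonneg _ (hmem hy) s hs
  have hs0 : 0 < s := by
    refine hs.1.lt_of_ne fun h => ?_
    rw [← h] at hpos hφ0
    linarith [hv.init y]
  have hyb : y ∈ ball x₀ R := by
    by_contra hn
    have hys : y ∈ sphere x₀ R := by
      rw [mem_sphere]
      exact le_antisymm hy (by simpa using hn)
    have := hbd y hys s hs
    rw [mem_sphere, dist_eq_norm] at hys
    rw [hys] at hpos
    linarith
  have hs' : s ∈ Ioc 0 T := ⟨hs0, hs.2⟩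
  obtain ⟨c, hc, hcle⟩ := hv.ineq y s hs0
  have hct : 0 ≤ c - φt (‖y - x₀‖ ^ 2) s := by
    have hd : HasDerivAt (fun b => v y b - φ (‖y - x₀‖ ^ 2) b)
        (c - φt (‖y - x₀‖ ^ 2) s) s := hc.sub (ht _ (hmem hy) s hs')
    refine nonneg_of_hasDerivAt_of_forall_le hs0 hd fun b hb => ?_
    exact hle y hy b ⟨hb.1, hb.2.trans hs.2⟩
  have hlmax : IsLocalMax (fun a : EuclideanSpace ℝ (Fin d) => v a s - φ (‖a - x₀‖ ^ 2) s) y := by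
    filter_upwards [isOpen_ball.mem_nhds hyb] with a ha
    exact hle a (ball_subset_closedBall ha) s hs
  have hev : ∀ᶠ N in 𝓝 (‖y - x₀‖ ^ 2), HasDerivAt (fun N => φ N s) (φ₁ N s) N :=
    Filter.Eventually.mono (hU.mem_nhds (hmem hy)) fun N hN => h1 N hN s hs'
  have hlap := laplacian_le_of_isLocalMax_sub_radial (hv.contDiff s hs0) (x := y) (x₀ := x₀)
    (φ := fun N => φ N s) (φ₁ := fun N => φ₁ N s)
    hev (h2 _ (hmem hy) s hs') hlmax
  have := mul_le_mul_of_nonneg_left hlap (hA y)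
  have := mul_le_mul_of_nonneg_left (Real.rpow_le_rpow hφ0 hpos.le hp) (hα y)
  have := hsuper y hyb s hs'
  linarith

/-- Translating in time by a moment at which `v` vanishes. -/
theorem shift (hv : IsNonnegSubsolution A α p v) {a : ℝ} (ha : 0 ≤ a) (h0 : ∀ x, v x a = 0) :
    IsNonnegSubsolution A α p fun x t => v x (t + a) where
  cont := by
    have h : Continuous fun q : EuclideanSpace ℝ (Fin d) × ℝ => (q.1, q.2 + a) := by fun_prop
    exact hv.cont.comp h.continuousOn fun q hq => ⟨mem_univ _, add_nonneg hq.2 ha⟩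
  nonneg x t ht := hv.nonneg x (t + a) (by positivity)
  contDiff t ht := hv.contDiff (t + a) (by positivity)
  ineq x t ht := by
    obtain ⟨c, hc, hle⟩ := hv.ineq x (t + a) (by positivity)
    exact ⟨c, hc.comp_add_const t a, hle⟩
  init x := by simpa using h0 x

theorem eq_zero_of_step {T : ℝ} (hT : 0 < T)
    (hstep : ∀ v, IsNonnegSubsolution A α p v → ∀ x, ∀ t ∈ Icc 0 T, v x t = 0)
    (hv : IsNonnegSubsolution A α p v) (x : EuclideanSpace ℝ (Fin d)) {t : ℝ} (ht : 0 ≤ t) :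
    v x t = 0 := by
  have key (n : ℕ) : ∀ v, IsNonnegSubsolution A α p v → ∀ x, ∀ t ∈ Icc 0 (n * T), v x t = 0 := by
    induction n with
    | zero =>
      intro v hv x t ht
      obtain rfl : t = 0 := by simpa using ht
      exact hv.init x
    | succ n ih =>
      intro v hv x t ht
      push_cast at ht
      rcases le_total t T with h | h
      · exact hstep v hv x t ⟨ht.1, h⟩
      · have := ih _ (hv.shift hT.le fun x => hstep v hv x T ⟨hT.le, le_rfl⟩) x (t - T)
          ⟨by linarith, by linarith [ht.2]⟩
        simpa using this
  obtain ⟨n, hn⟩ := exists_nat_ge (t / T)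
  exact key n v hv x t ⟨ht, (div_le_iff₀ hT).1 hn⟩

/-- Interior bound of Keller–Osserman type. -/
theorem le_of_forall_ball (hv : IsNonnegSubsolution A α p v) (hA : ∀ x, 0 ≤ A x)
    (hα : ∀ x, 0 ≤ α x) (hp : 1 < p) {γ c : ℝ} (hγ : γ = 2 / (p - 1))
    (hc : c = 2 * d * γ + 4 * γ * (γ + 1)) {x₀ : EuclideanSpace ℝ (Fin d)} {K : ℝ} (hK : 0 < K)
    (hAK : ∀ x ∈ ball x₀ 1, A x * c ≤ α x * K ^ (p - 1)) {t : ℝ} (ht : 0 ≤ t) : v x₀ t ≤ K := by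
  have hγ0 : 0 < γ := by
    rw [hγ]
    exact div_pos two_pos (by linarith)
  have hγp : -γ * p = -γ - 2 := by
    have : p - 1 ≠ 0 := by linarith
    rw [hγ]
    field_simp
    ring
  obtain ⟨B, hB⟩ : ∃ B, ∀ q ∈ closedBall x₀ 1 ×ˢ Icc (0 : ℝ) t, v q.1 q.2 ≤ B := by
    have := ((isCompact_closedBall x₀ 1).prod (isCompact_Icc (a := (0 : ℝ))
      (b := t))).bddAbove_image (hv.cont.mono (prod_mono (subset_univ _) Icc_subset_Ici_self))
    obtain ⟨B, hB⟩ := this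
    exact ⟨B, fun q hq => hB (mem_image_of_mem _ hq)⟩
  obtain ⟨δ, hδB, hδ0, hδ1⟩ : ∃ δ : ℝ, B / K ≤ δ ^ (-γ) ∧ 0 < δ ∧ δ < 1 :=
    (((tendsto_rpow_neg_nhdsGT_zero (neg_lt_zero.2 hγ0)).eventually_ge_atTop (B / K)).and
      (Ioo_mem_nhdsGT one_pos)).exists
  have hR : √(1 - δ) ^ 2 = 1 - δ := Real.sq_sqrt (by linarith)
  have hR1 : √(1 - δ) ≤ 1 := Real.sqrt_le_one.2 (by linarith)
  have hd (e N : ℝ) (hN : N ∈ Iio (1 : ℝ)) :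
      HasDerivAt (fun N : ℝ => (1 - N) ^ e) (-e * (1 - N) ^ (e - 1)) N := by
    have hN' : 1 - N ≠ 0 := by
      have := mem_Iio.1 hN
      linarith
    refine (((hasDerivAt_id N).const_sub 1).rpow_const (Or.inl hN')).congr_deriv ?_
    simp
  have key := hv.le_radial hA hα (by linarith) (x₀ := x₀) (R := √(1 - δ)) (T := t)
    (U := Iio 1) isOpen_Iio (fun N hN => by
      rw [hR] at hN
      exact mem_Iio.2 (by linarith [hN.2]))
    (φ := fun N _ => K * (1 - N) ^ (-γ)) (φ₁ := fun N _ => K * (- -γ * (1 - N) ^ (-γ - 1)))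
    (φ₂ := fun N _ => K * (- -γ * (-(-γ - 1) * (1 - N) ^ (-γ - 1 - 1)))) (φt := fun _ _ => 0)
    (by
      refine continuousOn_const.mul (ContinuousOn.rpow_const (by fun_prop) ?_)
      rintro ⟨N, s⟩ ⟨hN, -⟩
      exact Or.inl (by linarith [mem_Iio.1 hN]))
    (fun N hN s _ => by
      have : 0 ≤ 1 - N := by linarith [mem_Iio.1 hN]
      positivity)
    (fun N hN s _ => (hd _ N hN).const_mul K)
    (fun N hN s _ => ((hd _ N hN).const_mul (- -γ)).const_mul K)
    (fun N hN s _ => hasDerivAt_const _ _)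
    (fun x hx s _ => by
      rw [mem_ball, dist_eq_norm] at hx
      have hx1 : ‖x - x₀‖ ^ 2 < 1 := by nlinarith [norm_nonneg (x - x₀)]
      have hAKx := hAK x (by
        rw [mem_ball, dist_eq_norm]
        linarith)
      have hAx := hA x
      have hN0 : 0 ≤ ‖x - x₀‖ ^ 2 := by positivity
      generalize ‖x - x₀‖ ^ 2 = N at hx1 hN0 ⊢
      have hD : 0 < 1 - N := by linarith
      have hpow : (1 - N) ^ (-γ - 1) ≤ (1 - N) ^ (-γ - 2) :=
        Real.rpow_le_rpow_of_exponent_ge hD (by linarith) (by linarith)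
      have hDp : (K * (1 - N) ^ (-γ)) ^ p = K ^ (p - 1) * K * (1 - N) ^ (-γ - 2) := by
        rw [Real.mul_rpow hK.le (by positivity), ← Real.rpow_mul hD.le, hγp,
          Real.rpow_sub_one hK.ne']
        field_simp
      have hP : 0 ≤ (1 - N) ^ (-γ - 2) := by positivity
      rw [hDp, show -γ - 1 - 1 = -γ - 2 by ring]
      generalize (1 - N) ^ (-γ - 2) = P at hP hpow ⊢
      have e1 : 2 * d * (K * (- -γ * (1 - N) ^ (-γ - 1)))
          + 4 * N * (K * (- -γ * (-(-γ - 1) * P))) ≤ c * (K * P) := by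
        have i1 : 2 * d * (K * (- -γ * (1 - N) ^ (-γ - 1))) ≤ 2 * d * (K * (- -γ * P)) := by
          rw [neg_neg]
          gcongr
        have i2 : N * (4 * γ * (γ + 1) * (K * P)) ≤ 1 * (4 * γ * (γ + 1) * (K * P)) := by
          gcongr
        rw [hc]
        linarith
      have e2 := mul_le_mul_of_nonneg_left e1 hAx
      have e3 := mul_le_mul_of_nonneg_right hAKx (mul_nonneg hK.le hP)
      linarith)
    (fun x hx s hs => by
      rw [hR, sub_sub_cancel]
      have := hB (x, s) ⟨closedBall_subset_closedBall hR1 (sphere_subset_closedBall hx), hs⟩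
      rw [div_le_iff₀' hK] at hδB
      exact this.trans hδB)
    (x := x₀) (by simp) (t := t) ⟨ht, le_rfl⟩
  simpa using key

theorem exists_growth_bound (hA : ∀ x, 0 ≤ A x) (hp : 1 < p) {m C₀ C₁ C₂ : ℝ} (hm0 : 0 ≤ m)
    (hm2 : m ≤ 2) (hC₀ : 0 < C₀) (hA' : ∀ x, A x ≤ C₀ * (1 + ‖x‖) ^ m) (hC₁ : 0 < C₁)
    (hC₂ : 0 < C₂) (hα : ∀ x, C₁ * Real.exp (-C₂ * ‖x‖ ^ (2 - m)) ≤ α x) {γ : ℝ}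
    (hγ : γ = 2 / (p - 1)) :
    ∃ B, ∀ v, IsNonnegSubsolution A α p v → ∀ x, ∀ t, 0 ≤ t →
      v x t ≤ B * (1 + ‖x‖ ^ 2) ^ (γ / 2)
        * Real.exp (γ * C₂ * (1 + ‖x‖ ^ 2) ^ ((2 - m) / 2)) := by
  have hγ0 : 0 < γ := by
    rw [hγ]
    exact div_pos two_pos (by linarith)
  have hα0 (x : EuclideanSpace ℝ (Fin d)) : 0 ≤ α x := le_trans (by positivity) (hα x)
  obtain ⟨c, hc⟩ : ∃ c : ℝ, c = 2 * d * γ + 4 * γ * (γ + 1) := ⟨_, rfl⟩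
  have hc0 : 0 < c := by
    rw [hc]
    positivity
  set Q := 8 * c * C₀ / C₁ with hQ
  have hQ0 : 0 < Q := by positivity
  refine ⟨Q ^ (γ / 2), fun v hv x₀ t ht => ?_⟩
  set s := 1 + ‖x₀‖ ^ 2 with hs
  have hs0 : 0 < s := by positivity
  set S := s ^ ((2 - m) / 2)
  have hK : (Q * s * Real.exp (2 * C₂ * S)) ^ (γ / 2)
      = Q ^ (γ / 2) * s ^ (γ / 2) * Real.exp (γ * C₂ * S) := by
    rw [Real.mul_rpow (by positivity) (by positivity), Real.mul_rpow hQ0.le hs0.le,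
      ← Real.exp_mul]
    ring_nf
  rw [← hK]
  refine hv.le_of_forall_ball hA hα0 hp hγ hc (by positivity) (fun x hx => ?_) ht
  have hp1 : γ / 2 * (p - 1) = 1 := by
    have : p - 1 ≠ 0 := by linarith
    rw [hγ]
    field_simp
  rw [← Real.rpow_mul (by positivity), hp1, Real.rpow_one]
  have hxn : ‖x‖ ≤ 1 + ‖x₀‖ := by
    rw [mem_ball, dist_eq_norm] at hx
    linarith [norm_le_norm_add_norm_sub' x x₀]
  have hAx : A x ≤ 8 * C₀ * s := by
    calc A x ≤ C₀ * (1 + ‖x‖) ^ m := hA' x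
      _ ≤ C₀ * (1 + ‖x‖) ^ (2 : ℝ) := by
        gcongr
        linarith [norm_nonneg x]
      _ ≤ C₀ * (8 * s) := by
        gcongr
        rw [Real.rpow_two, hs]
        nlinarith [norm_nonneg x, norm_nonneg x₀, sq_nonneg (‖x₀‖ - 1)]
      _ = 8 * C₀ * s := by ring
  have hexp : ‖x‖ ^ (2 - m) ≤ 2 * S :=
    (Real.rpow_le_rpow (norm_nonneg x) hxn (by linarith)).trans
      (one_add_rpow_le (norm_nonneg x₀) (by linarith) (by linarith))
  calc A x * c ≤ 8 * C₀ * s * c := by gcongr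
    _ = C₁ * (Q * s) := by
      rw [hQ]
      field_simp
    _ = C₁ * Real.exp (-C₂ * (2 * S)) * (Q * s * Real.exp (2 * C₂ * S)) := by
      have : Real.exp (-C₂ * (2 * S)) * Real.exp (2 * C₂ * S) = 1 := by
        rw [← Real.exp_add, ← Real.exp_zero]
        ring_nf
      linear_combination (-(C₁ * (Q * s))) * this
    _ ≤ α x * (Q * s * Real.exp (2 * C₂ * S)) := by
      gcongr
      refine le_trans ?_ (hα x)
      gcongr ?_ * Real.exp ?_
      nlinarith

theorem exists_vanishing_time (hA : ∀ x, 0 ≤ A x) (hα : ∀ x, 0 ≤ α x) (hp : 0 ≤ p)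
    {C₀ q B k g₀ : ℝ} (hC₀ : 0 < C₀) (hq0 : 0 ≤ q) (hq1 : q ≤ 1)
    (hA' : ∀ x, A x ≤ 2 * C₀ * (1 + ‖x‖ ^ 2) ^ (1 - q)) (hk : 0 ≤ k)
    (hg₀ : 0 ≤ g₀)
    (hgrowth : ∀ v, IsNonnegSubsolution A α p v → ∀ x, ∀ t, 0 ≤ t →
      v x t ≤ B * (1 + ‖x‖ ^ 2) ^ k * Real.exp (g₀ * (1 + ‖x‖ ^ 2) ^ q)) :
    ∃ T, 0 < T ∧ ∀ v, IsNonnegSubsolution A α p v → ∀ x, ∀ t ∈ Icc 0 T, v x t = 0 := by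
  obtain ⟨G, hG⟩ : ∃ G, G = (k + 1) + (g₀ + 1) := ⟨_, rfl⟩
  obtain ⟨lam, hlam⟩ : ∃ lam, lam = C₀ * (4 * d * G + 8 * G ^ 2) := ⟨_, rfl⟩
  have hG0 : 0 < G := by linarith
  have hlam0 : 0 < lam := by
    rw [hlam]
    positivity
  refine ⟨1 / lam, by positivity, fun v hv x t ht => ?_⟩
  set L : ℝ → ℝ → ℝ := fun N t => (k + 1) * Real.log (1 + N) + (g₀ + lam * t) * (1 + N) ^ q
    with hL
  set L₁ : ℝ → ℝ → ℝ :=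
    fun N t => (k + 1) / (1 + N) + (g₀ + lam * t) * (q * (1 + N) ^ (q - 1)) with hL₁
  set L₂ : ℝ → ℝ → ℝ := fun N t => -(k + 1) / (1 + N) ^ 2
    + (g₀ + lam * t) * (q * ((q - 1) * (1 + N) ^ (q - 1 - 1))) with hL₂
  have hne {N : ℝ} (hN : N ∈ Ioi (-1 : ℝ)) : 1 + N ≠ 0 := by
    have := mem_Ioi.1 hN
    linarith
  have hdpow (e N : ℝ) (hN : N ∈ Ioi (-1 : ℝ)) :
      HasDerivAt (fun N : ℝ => (1 + N) ^ e) (e * (1 + N) ^ (e - 1)) N := by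
    refine (((hasDerivAt_id N).const_add 1).rpow_const (Or.inl (hne hN))).congr_deriv ?_
    simp
  have hdL (N : ℝ) (hN : N ∈ Ioi (-1 : ℝ)) (t : ℝ) :
      HasDerivAt (fun N => L N t) (L₁ N t) N := by
    refine (((((hasDerivAt_id N).const_add 1).log (hne hN)).const_mul (k + 1)).add
      ((hdpow q N hN).const_mul (g₀ + lam * t))).congr_deriv ?_
    simp [hL₁]
    ring
  have hdL₁ (N : ℝ) (hN : N ∈ Ioi (-1 : ℝ)) (t : ℝ) :
      HasDerivAt (fun N => L₁ N t) (L₂ N t) N := by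
    have h := (((hasDerivAt_id N).const_add 1).inv (hne hN)).const_mul (k + 1)
    refine (h.add (((hdpow (q - 1) N hN).const_mul q).const_mul (g₀ + lam * t))).congr_deriv ?_
    simp [hL₂]
    ring
  have hbarrier {ε : ℝ} (hε : 0 < ε) : v x t ≤ ε * Real.exp (L (‖x‖ ^ 2) t) := by
    obtain ⟨R, hR⟩ : ∃ R, R = max ‖x‖ (B / ε) := ⟨_, rfl⟩
    have hxR : ‖x‖ ≤ R := hR ▸ le_max_left _ _
    have hBR : B ≤ ε * R := by
      rw [← div_le_iff₀' hε]
      exact hR ▸ le_max_right _ _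
    have key := hv.le_radial hA hα hp (x₀ := 0) (R := R) (T := 1 / lam) (U := Ioi (-1))
      isOpen_Ioi (fun N hN => mem_Ioi.2 (by linarith [hN.1]))
      (φ := fun N t => ε * Real.exp (L N t)) (φ₁ := fun N t => ε * (Real.exp (L N t) * L₁ N t))
      (φ₂ := fun N t => ε * (Real.exp (L N t) * L₁ N t * L₁ N t + Real.exp (L N t) * L₂ N t))
      (φt := fun N t => ε * (Real.exp (L N t) * (lam * (1 + N) ^ q)))
      (by
        have h1 : ContinuousOn (fun q : ℝ × ℝ => 1 + q.1) (Ioi (-1) ×ˢ Icc 0 (1 / lam)) := by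
          fun_prop
        refine continuousOn_const.mul (Real.continuous_exp.comp_continuousOn ?_)
        exact (continuousOn_const.mul (h1.log fun q hq => hne hq.1)).add
          (ContinuousOn.mul (by fun_prop) (h1.rpow_const fun q hq => Or.inl (hne hq.1))))
      (fun N _ s _ => by positivity)
      (fun N hN s _ => (hdL N hN s).exp.const_mul ε)
      (fun N hN s _ => ((hdL N hN s).exp.mul (hdL₁ N hN s)).const_mul ε)
      (fun N hN s _ => by
        refine HasDerivAt.const_mul ε (HasDerivAt.exp ?_)
        refine (((((hasDerivAt_id s).const_mul lam).const_add g₀).mul_const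
          ((1 + N) ^ q)).const_add
          ((k + 1) * Real.log (1 + N))).congr_deriv ?_
        simp)
      (fun y _ s hs => by
        have hls : lam * s ≤ 1 := by
          have := hs.2
          rwa [le_div_iff₀' hlam0] at this
        have hls0 : 0 ≤ lam * s := mul_nonneg hlam0.le hs.1.le
        have hAy := hA' y
        rw [sub_zero]
        have hN0 : 0 ≤ ‖y‖ ^ 2 := by positivity
        generalize ‖y‖ ^ 2 = N at hAy hN0 ⊢
        have hin := barrier_inequality (s := 1 + N) (g := g₀ + lam * s) (k := k + 1) (G := G)
          (b := d) (by linarith) hq0 hq1 (by linarith) (by linarith) (by linarith) (hA y)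
          (by positivity) hC₀.le hAy hlam.ge
        rw [add_sub_cancel_left] at hin
        change A y * (2 * d * L₁ N s + 4 * N * (L₁ N s ^ 2 + L₂ N s)) ≤ _ at hin
        have hexp : 0 ≤ ε * Real.exp (L N s) := by positivity
        have h1 := mul_le_mul_of_nonneg_left hin hexp
        have h2 : 0 ≤ α y * (ε * Real.exp (L N s)) ^ p :=
          mul_nonneg (hα y) (Real.rpow_nonneg hexp p)
        linarith)
      (fun y hy s hs => by
        have hyR : ‖y‖ = R := by simpa using hy
        have hR1 : 0 < 1 + R ^ 2 := by positivity
        have hls0 : 0 ≤ lam * s := mul_nonneg hlam0.le hs.1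
        have hgr := hgrowth v hv y s hs.1
        rw [hyR] at hgr
        refine hgr.trans ?_
        calc B * (1 + R ^ 2) ^ k * Real.exp (g₀ * (1 + R ^ 2) ^ q)
            ≤ ε * (1 + R ^ 2) * (1 + R ^ 2) ^ k
                * Real.exp ((g₀ + lam * s) * (1 + R ^ 2) ^ q) := by
              gcongr
              · exact hBR.trans (by gcongr; nlinarith [sq_nonneg (R - 1)])
              · linarith
          _ = ε * Real.exp (L (R ^ 2) s) := by
              simp only [hL]
              rw [Real.exp_add, mul_comm (k + 1), ← Real.rpow_def_of_pos hR1,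
                Real.rpow_add_one hR1.ne']
              ring)
      (x := x) (by simpa using hxR) (t := t) ht
    simpa using key
  by_contra hne0
  have hpos : 0 < v x t := (hv.nonneg x t ht.1).lt_of_ne' hne0
  have hexp : 0 < Real.exp (L (‖x‖ ^ 2) t) := Real.exp_pos _
  have := hbarrier (ε := v x t / (2 * Real.exp (L (‖x‖ ^ 2) t))) (by positivity)
  have heq : v x t / (2 * Real.exp (L (‖x‖ ^ 2) t)) * Real.exp (L (‖x‖ ^ 2) t) = v x t / 2 := by
    field_simp
  linarith

end IsNonnegSubsolution

end

/-- Theorem 1, part (1): if `L = A(x)Δ` with `A` comparable to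
`(1+|x|)^m`, `m ∈ [0,2]`, and `α(x) ≥ C₁ exp(−C₂|x|^{2−m})`, then the only nonnegative
classical solution of `u_t = AΔu + βu − αu^p` with zero initial data is `u ≡ 0`. -/
theorem stmt_2 {d : ℕ} (hd : 1 ≤ d) (p : ℝ) (hp1 : 1 < p) (hp2 : p ≤ 2)
    (m : ℝ) (hm0 : 0 ≤ m) (hm2 : m ≤ 2)
    (A : EuclideanSpace ℝ (Fin d) → ℝ) (hA_holder : LocHolder A)
    (C₀ : ℝ) (hC₀ : 0 < C₀)
    (hA_bound : ∀ x, C₀⁻¹ * (1 + ‖x‖) ^ m ≤ A x ∧ A x ≤ C₀ * (1 + ‖x‖) ^ m)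
    (α β : EuclideanSpace ℝ (Fin d) → ℝ)
    (hα_holder : LocHolder α) (hβ_holder : LocHolder β)
    (hα_pos : ∀ x, 0 < α x)
    (hβ_bdd : ∃ M : ℝ, ∀ x, β x ≤ M)
    (C₁ C₂ : ℝ) (hC₁ : 0 < C₁) (hC₂ : 0 < C₂)
    (hα_lower : ∀ x, C₁ * Real.exp (-C₂ * ‖x‖ ^ (2 - m)) ≤ α x)
    (u : EuclideanSpace ℝ (Fin d) → ℝ → ℝ)
    (hu_cont : ContinuousOn (fun q : EuclideanSpace ℝ (Fin d) × ℝ => u q.1 q.2)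
      (univ ×ˢ Ici (0 : ℝ)))
    (hu_nonneg : ∀ x t, 0 ≤ t → 0 ≤ u x t)
    (hu_x : ∀ t : ℝ, 0 < t → ContDiff ℝ 2 (fun x => u x t))
    (hu_t : ∀ x, ContDiffOn ℝ 1 (fun s => u x s) (Ioi (0 : ℝ)))
    (hpde : ∀ x t, 0 < t →
      deriv (fun s => u x s) t =
        A x * (∑ i, pd i (pd i (fun y => u y t)) x)
          + β x * u x t - α x * u x t ^ p)
    (hinit : ∀ x, u x 0 = 0) :
    ∀ x t, 0 ≤ t → u x t = 0 := by
  obtain ⟨M', hM'⟩ := hβ_bdd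
  obtain ⟨M, hM0, hM⟩ : ∃ M : ℝ, 0 ≤ M ∧ ∀ x, β x ≤ M :=
    ⟨max M' 0, le_max_right _ _, fun x => (hM' x).trans (le_max_left _ _)⟩
  have hA0 (x : EuclideanSpace ℝ (Fin d)) : 0 ≤ A x := le_trans (by positivity) (hA_bound x).1
  have hα0 (x : EuclideanSpace ℝ (Fin d)) : 0 ≤ α x := (hα_pos x).le
  have hv : IsNonnegSubsolution A α p fun x t => Real.exp (-(M + 1) * t) * u x t := by
    refine ⟨?_, ?_, ?_, ?_, ?_⟩
    · exact ContinuousOn.mul (by fun_prop) hu_cont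
    · exact fun x t ht => mul_nonneg (Real.exp_pos _).le (hu_nonneg x t ht)
    · exact fun t ht => contDiff_const.mul (hu_x t ht)
    · intro x t ht
      have hu : HasDerivAt (fun s => u x s) (deriv (fun s => u x s) t) t :=
        (((hu_t x).differentiableOn (by norm_num)).differentiableAt
          (Ioi_mem_nhds ht)).hasDerivAt
      have he : HasDerivAt (fun s => Real.exp (-(M + 1) * s))
          (Real.exp (-(M + 1) * t) * -(M + 1)) t := by
        simpa using ((hasDerivAt_id t).const_mul (-(M + 1))).exp
      refine ⟨_, he.mul hu, ?_⟩
      rw [hpde x t ht]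
      simp only [pd_const_mul, ← Finset.mul_sum]
      have hut := hu_nonneg x t ht.le
      have he1 : Real.exp (-(M + 1) * t) ≤ 1 := Real.exp_le_one_iff.2 (by nlinarith)
      have he0 := Real.exp_pos (-(M + 1) * t)
      generalize Real.exp (-(M + 1) * t) = e at he0 he1 ⊢
      have hep : e ^ p ≤ e := Real.rpow_le_self_of_le_one he0.le he1 hp1.le
      rw [Real.mul_rpow he0.le hut]
      have h1 := mul_le_mul_of_nonneg_right hep
        (mul_nonneg (hα0 x) (Real.rpow_nonneg hut p))
      have h2 := mul_le_mul_of_nonneg_right (hM x) (mul_nonneg he0.le hut)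
      linarith
    · intro x
      simp [hinit]
  have hγ0 : 0 < 2 / (p - 1) := div_pos two_pos (by linarith)
  obtain ⟨B, hB⟩ := IsNonnegSubsolution.exists_growth_bound (α := α) hA0 hp1 hm0 hm2 hC₀
    (fun x => (hA_bound x).2) hC₁ hC₂ hα_lower rfl
  obtain ⟨T, hT0, hT⟩ := IsNonnegSubsolution.exists_vanishing_time hA0 hα0 (p := p) (by linarith)
    (q := (2 - m) / 2) hC₀ (by linarith) (by linarith) (fun x => by
      have h := one_add_rpow_le (norm_nonneg x) hm0 hm2
      rw [show 1 - (2 - m) / 2 = m / 2 by ring]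
      calc A x ≤ C₀ * (1 + ‖x‖) ^ m := (hA_bound x).2
        _ ≤ C₀ * (2 * (1 + ‖x‖ ^ 2) ^ (m / 2)) := by gcongr
        _ = 2 * C₀ * (1 + ‖x‖ ^ 2) ^ (m / 2) := by ring) (by positivity) (by positivity) hB
  intro x t ht
  exact (mul_eq_zero.1 (hv.eq_zero_of_step hT0 hT x ht)).resolve_left (Real.exp_pos _).ne'
end
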